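/- arXiv:1102.0267 — 2 statements merged into one kernel-verified Lean document; each statement's English description precedes it below -/
import Mathlib

section
/- With the channel setup below, the following determinant inequality holds: det(I_{N1} + ρ11·H11·K1u·H11† + (ρ21/M2)·H21·H21†) ≥ det(I_{N1} + ρ11·H11·K1·H11† + ρ21·H21·H21†) · det(I_{N1} + ρ21·H21·K2u·H21†) / ( (max(M1,M2))^{min(N1, M1+M2)} · ((M2+1)/M2)^{min(M2,N1)} ), where all determinants are positive real numbers. -/
open Matrix ComplexOrder

/-- `KK H ρ = (I + ρ·H†·H)⁻¹`. -/
noncomputable def KK {m n : ℕ} (H : Matrix (Fin n) (Fin m) ℂ) (ρ : ℝ) :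
    Matrix (Fin m) (Fin m) ℂ :=
  (1 + (ρ : ℂ) • (Hᴴ * H))⁻¹

/-- `Ku H ρ = (1/m)·(I + ρ·H†·H)⁻¹` where `m` is the column dimension. -/
noncomputable def Ku {m n : ℕ} (H : Matrix (Fin n) (Fin m) ℂ) (ρ : ℝ) :
    Matrix (Fin m) (Fin m) ℂ :=
  ((m : ℂ))⁻¹ • KK H ρ

section DetMonotone

variable {𝕜 m n : Type*} [RCLike 𝕜] [Fintype m] [Fintype n] [DecidableEq m] [DecidableEq n]

theorem Matrix.PosSemidef.exists_eq_mul_conjTranspose {P : Matrix n n 𝕜} (hP : P.PosSemidef) :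
    ∃ X : Matrix n n 𝕜, P = X * Xᴴ := by
  open scoped MatrixOrder in
  obtain ⟨X, hX⟩ := CStarAlgebra.nonneg_iff_eq_mul_star_self.mp hP.nonneg
  exact ⟨X, hX⟩

theorem Matrix.PosSemidef.one_le_det_one_add {P : Matrix n n 𝕜} (hP : P.PosSemidef) :
    1 ≤ (1 + P).det := by
  have hdet : (1 + P).det = ∏ i, (1 + (hP.1.eigenvalues i : 𝕜)) := by
    have h := hP.1.spectral_theorem
    rw [Unitary.conjStarAlgAut_apply] at h
    have hone : (1 : Matrix n n 𝕜) = (hP.1.eigenvectorUnitary : Matrix n n 𝕜) * 1 *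
        star (hP.1.eigenvectorUnitary : Matrix n n 𝕜) := by simp
    nth_rewrite 1 [h, hone]
    rw [← add_mul, ← mul_add, det_mul_right_comm,
      Unitary.mul_star_self_of_mem hP.1.eigenvectorUnitary.2, one_mul,
      ← diagonal_one, diagonal_add, det_diagonal]
    rfl
  rw [hdet]
  calc (1 : 𝕜) = ∏ _i : n, (1 : 𝕜) := by simp
    _ ≤ _ := Finset.prod_le_prod (fun _ _ => zero_le_one) fun i _ => by
      simpa using hP.eigenvalues_nonneg i

theorem Matrix.PosDef.det_le_det_add {A P : Matrix n n 𝕜} (hA : A.PosDef) (hP : P.PosSemidef) :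
    A.det ≤ (A + P).det := by
  obtain ⟨X, rfl⟩ := hP.exists_eq_mul_conjTranspose
  rw [det_add_mul X Xᴴ ((isUnit_iff_isUnit_det A).mp hA.isUnit)]
  exact le_mul_of_one_le_right hA.det_pos.le
    (hA.inv.posSemidef.conjTranspose_mul_mul_same X).one_le_det_one_add

theorem Matrix.PosSemidef.det_one_add_le_pow_mul {P : Matrix n n 𝕜} (hP : P.PosSemidef) {c : 𝕜}
    (hc : 1 ≤ c) : (1 + P).det ≤ c ^ Fintype.card n * (1 + c⁻¹ • P).det := by
  have hc0 : c ≠ 0 := (zero_lt_one.trans_le hc).ne'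
  have h := (PosDef.one.add_posSemidef hP).det_le_det_add
    (PosSemidef.one.smul (sub_nonneg.mpr hc))
  rw [← det_smul, smul_add, smul_inv_smul₀ hc0]
  convert h using 2
  module

theorem Matrix.det_one_add_mul_conjTranspose_le_pow_min_mul (G : Matrix n m 𝕜) {c : 𝕜}
    (hc : 1 ≤ c) : (1 + G * Gᴴ).det ≤
      c ^ min (Fintype.card n) (Fintype.card m) * (1 + c⁻¹ • (G * Gᴴ)).det := by
  rcases min_choice (Fintype.card n) (Fintype.card m) with h | h <;> rw [h]
  · exact (posSemidef_self_mul_conjTranspose G).det_one_add_le_pow_mul hc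
  · rw [← Matrix.smul_mul, det_one_add_mul_comm G, det_one_add_mul_comm (c⁻¹ • G), Matrix.mul_smul]
    exact (posSemidef_conjTranspose_mul_self G).det_one_add_le_pow_mul hc

theorem Matrix.PosSemidef.det_one_add_smul_one_sub_le {K : Matrix n n 𝕜} (hK : K.PosSemidef)
    (hK1 : (1 - K).PosSemidef) {c : 𝕜} (hc : 0 ≤ c) :
    (1 + c • (1 - K)).det ≤ (1 + c) ^ Fintype.card n := by
  have h := (PosDef.one.add_posSemidef (hK1.smul hc)).det_le_det_add (hK.smul hc)
  have he : 1 + c • (1 - K) + c • K = (1 + c) • (1 : Matrix n n 𝕜) := by module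
  rwa [he, det_smul, det_one, mul_one] at h

theorem Matrix.inv_one_add_mul_self {P : Matrix n n 𝕜} (h : IsUnit (1 + P)) :
    (1 + P)⁻¹ * P = 1 - (1 + P)⁻¹ := by
  rw [eq_sub_iff_add_eq]
  nth_rewrite 2 [← Matrix.mul_one (1 + P)⁻¹]
  rw [← Matrix.mul_add, add_comm P, nonsing_inv_mul _ ((isUnit_iff_isUnit_det _).mp h)]

theorem Matrix.mul_inv_one_add_mul_mul (A : Matrix n m 𝕜) (B : Matrix m n 𝕜)
    (h : IsUnit (1 + B * A)) (h' : IsUnit (1 + A * B)) :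
    A * (1 + B * A)⁻¹ * B = 1 - (1 + A * B)⁻¹ := by
  have hd := (isUnit_iff_isUnit_det _).mp h
  have hd' := (isUnit_iff_isUnit_det _).mp h'
  have hcomm : (1 + A * B)⁻¹ * A = A * (1 + B * A)⁻¹ := by
    rw [← nonsing_inv_mul_cancel_left _ (A * (1 + B * A)⁻¹) hd', ← Matrix.mul_assoc (1 + A * B)]
    have hA : (1 + A * B) * A = A * (1 + B * A) := by
      simp [Matrix.add_mul, Matrix.mul_add, Matrix.mul_assoc]
    rw [hA, mul_nonsing_inv_cancel_right _ _ hd]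
  rw [← hcomm, Matrix.mul_assoc, inv_one_add_mul_self h']

theorem Matrix.det_one_add_smul_mul_inv_mul_le (G : Matrix n m 𝕜) {c : 𝕜} (hc : 0 ≤ c) :
    (1 + c • (G * (1 + Gᴴ * G)⁻¹ * Gᴴ)).det ≤
      (1 + c) ^ min (Fintype.card m) (Fintype.card n) := by
  have h : (1 + Gᴴ * G).PosDef := PosDef.one.add_posSemidef (posSemidef_conjTranspose_mul_self G)
  have h' : (1 + G * Gᴴ).PosDef := PosDef.one.add_posSemidef (posSemidef_self_mul_conjTranspose G)
  rcases min_choice (Fintype.card m) (Fintype.card n) with hm | hm <;> rw [hm]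
  · have hP := h'.inv.posSemidef.conjTranspose_mul_mul_same G
    rw [mul_inv_one_add_mul_mul Gᴴ G h'.isUnit h.isUnit] at hP
    rw [Matrix.mul_assoc, ← Matrix.mul_smul, det_one_add_mul_comm, Matrix.smul_mul,
      Matrix.mul_assoc, inv_one_add_mul_self h.isUnit]
    exact h.inv.posSemidef.det_one_add_smul_one_sub_le hP hc
  · have hP := h.inv.posSemidef.mul_mul_conjTranspose_same G
    rw [mul_inv_one_add_mul_mul G Gᴴ h.isUnit h'.isUnit] at hP ⊢
    exact h'.inv.posSemidef.det_one_add_smul_one_sub_le hP hc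

end DetMonotone

theorem posDef_KK {m n : ℕ} (H : Matrix (Fin n) (Fin m) ℂ) {ρ : ℝ} (hρ : 0 ≤ ρ) :
    (KK H ρ).PosDef :=
  (PosDef.one.add_posSemidef ((posSemidef_conjTranspose_mul_self H).smul
    (Complex.zero_le_real.mpr hρ))).inv

theorem det_one_add_Ku_le {m n : ℕ} (H : Matrix (Fin n) (Fin m) ℂ) {ρ : ℝ} (hρ : 0 ≤ ρ) :
    (1 + (ρ : ℂ) • (H * Ku H ρ * Hᴴ)).det ≤ (1 + (m : ℂ)⁻¹) ^ min m n := by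
  have h := det_one_add_smul_mul_inv_mul_le ((√ρ : ℂ) • H) (c := (m : ℂ)⁻¹) (by positivity)
  have hs : (√ρ : ℂ) * √ρ = ρ := by exact_mod_cast Real.mul_self_sqrt hρ
  simp only [conjTranspose_smul, Matrix.smul_mul, Matrix.mul_smul, smul_smul, RCLike.star_def,
    Complex.conj_ofReal, hs, Fintype.card_fin] at h
  simpa only [Ku, KK, Matrix.smul_mul, Matrix.mul_smul, smul_smul, mul_comm (ρ : ℂ)] using h

theorem Matrix.PosSemidef.det_one_add_add_le {m n k : Type*} [Fintype m] [Fintype n] [Fintype k]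
    [DecidableEq m] [DecidableEq n] [DecidableEq k] {K : Matrix m m ℂ} (hK : K.PosSemidef)
    (F : Matrix n m ℂ) (H : Matrix n k ℂ) {a b : ℝ} (ha : 0 ≤ a) (hb : 0 ≤ b) {c : ℂ}
    (hc : 1 ≤ c) :
    (1 + (a : ℂ) • (F * K * Fᴴ) + (b : ℂ) • (H * Hᴴ)).det ≤
      c ^ min (Fintype.card n) (Fintype.card m + Fintype.card k) *
        (1 + c⁻¹ • ((a : ℂ) • (F * K * Fᴴ) + (b : ℂ) • (H * Hᴴ))).det := by
  obtain ⟨X, rfl⟩ := hK.exists_eq_mul_conjTranspose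
  have hsa : (√a : ℂ) * √a = a := by exact_mod_cast Real.mul_self_sqrt ha
  have hsb : (√b : ℂ) * √b = b := by exact_mod_cast Real.mul_self_sqrt hb
  have h := det_one_add_mul_conjTranspose_le_pow_min_mul
    (fromCols ((√a : ℂ) • (F * X)) ((√b : ℂ) • H)) hc
  simp only [conjTranspose_fromCols_eq_fromRows_conjTranspose, fromCols_mul_fromRows,
    conjTranspose_smul, conjTranspose_mul, Matrix.smul_mul, Matrix.mul_smul, smul_smul,
    RCLike.star_def, Complex.conj_ofReal, hsa, hsb, Fintype.card_sum] at h
  simpa only [Matrix.mul_assoc, add_assoc] using h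

/-- With `K1 = (I_{M1}+ρ12·H12†H12)⁻¹`, `K1u = K1/M1`,
`K2u = (1/M2)·(I_{M2}+ρ21·H21†H21)⁻¹`:
`det(I + ρ11·H11·K1u·H11† + (ρ21/M2)·H21·H21†) ≥
 det(I + ρ11·H11·K1·H11† + ρ21·H21·H21†)·det(I + ρ21·H21·K2u·H21†)
  / ((max(M1,M2))^{min(N1,M1+M2)}·((M2+1)/M2)^{min(M2,N1)})`. -/
theorem stmt_12 (M1 M2 N1 N2 : ℕ) (hM1 : 0 < M1) (hM2 : 0 < M2) (hN1 : 0 < N1) (hN2 : 0 < N2)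
    (H11 : Matrix (Fin N1) (Fin M1) ℂ) (H21 : Matrix (Fin N1) (Fin M2) ℂ)
    (H12 : Matrix (Fin N2) (Fin M1) ℂ) (H22 : Matrix (Fin N2) (Fin M2) ℂ)
    (ρ11 ρ12 ρ21 ρ22 : ℝ) (h11 : 0 ≤ ρ11) (h12 : 0 ≤ ρ12) (h21 : 0 ≤ ρ21) (h22 : 0 ≤ ρ22) :
    ((1 + (ρ11 : ℂ) • (H11 * KK H12 ρ12 * H11ᴴ) + (ρ21 : ℂ) • (H21 * H21ᴴ)).det).re
        * ((1 + (ρ21 : ℂ) • (H21 * Ku H21 ρ21 * H21ᴴ)).det).re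
        / (((max M1 M2 : ℕ) : ℝ) ^ (min N1 (M1 + M2))
            * (((M2 : ℝ) + 1) / M2) ^ (min M2 N1))
      ≤ ((1 + (ρ11 : ℂ) • (H11 * Ku H12 ρ12 * H11ᴴ)
          + ((ρ21 / M2 : ℝ) : ℂ) • (H21 * H21ᴴ)).det).re := by
  have hA := (posDef_KK H12 h12).posSemidef.mul_mul_conjTranspose_same H11
  have hB := posSemidef_self_mul_conjTranspose H21
  set A := H11 * KK H12 ρ12 * H11ᴴ with hAdef
  set B := H21 * H21ᴴ with hBdef
  have hρA := hA.smul (Complex.zero_le_real.mpr h11)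
  have hρB := hB.smul (Complex.zero_le_real.mpr h21)
  have hM1R : (0 : ℝ) < M1 := by exact_mod_cast hM1
  have hM2R : (0 : ℝ) < M2 := by exact_mod_cast hM2
  have hc1 : (M1 : ℝ) ≤ (max M1 M2 : ℕ) := by exact_mod_cast le_max_left _ _
  have hc2 : (M2 : ℝ) ≤ (max M1 M2 : ℕ) := by exact_mod_cast le_max_right _ _
  have hcone : 1 ≤ max M1 M2 := hM1.trans_le (le_max_left _ _)
  set c : ℝ := ((max M1 M2 : ℕ) : ℝ) with hc
  have hc0 : 0 < c := hM1R.trans_le hc1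
  have hcC : (1 : ℂ) ≤ (c : ℂ) := by
    rw [← Complex.ofReal_one, Complex.real_le_real, hc]
    exact_mod_cast hcone
  have hsum := (posDef_KK H12 h12).posSemidef.det_one_add_add_le H11 H21 h11 h21 hcC
  have hcross := det_one_add_Ku_le H21 h21
  have hscale : (1 + (c : ℂ)⁻¹ • ((ρ11 : ℂ) • A + (ρ21 : ℂ) • B)).det ≤
      (1 + (ρ11 : ℂ) • (H11 * Ku H12 ρ12 * H11ᴴ) + ((ρ21 / M2 : ℝ) : ℂ) • B).det := by
    have hinv : 0 ≤ (c : ℂ)⁻¹ := by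
      rw [← Complex.ofReal_inv]; exact Complex.zero_le_real.mpr (by positivity)
    have hgap : ∀ {M : ℝ}, 0 < M → M ≤ c → (0 : ℂ) ≤ ((M⁻¹ - c⁻¹ : ℝ) : ℂ) := fun hM hMc =>
      Complex.zero_le_real.mpr (sub_nonneg.mpr (inv_anti₀ hM hMc))
    have h := (PosDef.one.add_posSemidef ((hρA.add hρB).smul hinv)).det_le_det_add
      ((hρA.smul (hgap hM1R hc1)).add (hρB.smul (hgap hM2R hc2)))
    convert h using 1
    congr 1
    simp only [Ku, Matrix.mul_smul, Matrix.smul_mul, ← hAdef]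
    push_cast
    module
  simp only [← hAdef, ← hBdef, Fintype.card_fin] at hsum
  have hpos := (Complex.lt_def.mp
    ((PosDef.one.add_posSemidef hρA).add_posSemidef hρB).det_pos).1
  have hsum_re := (Complex.le_def.mp (hsum.trans
    (mul_le_mul_of_nonneg_left hscale (pow_nonneg (zero_le_one.trans hcC) _)))).1
  have hcross_re := (Complex.le_def.mp hcross).1
  rw [← Complex.ofReal_pow, Complex.re_ofReal_mul] at hsum_re
  have hq : (1 + (M2 : ℂ)⁻¹) = ((((M2 : ℝ) + 1) / M2 : ℝ) : ℂ) := by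
    push_cast
    field_simp
  rw [hq, ← Complex.ofReal_pow, Complex.ofReal_re] at hcross_re
  rw [div_le_iff₀ (by positivity)]
  calc _ ≤ _ := mul_le_mul_of_nonneg hsum_re hcross_re hpos.le (by positivity)
    _ = _ := by ring
end

section
/- With the channel setup, explicit Gaussian Han–Kobayashi quantities, constants n1, n2 and region R_a defined below, R_a is contained in the explicit Han–Kobayashi region: every pair (R1,R2) ∈ R_a satisfies all nine inequalities R1 ≤ Id1; R1 ≤ Ia1 + IW1; R2 ≤ Id2; R2 ≤ Ia2 + IW2; R1+R2 ≤ Ig2 + Ia1; R1+R2 ≤ Ig1 + Ia2; R1+R2 ≤ Ie1 + Ie2; 2R1+R2 ≤ Ig1 + Ia1 + Ie2; R1+2R2 ≤ Ig2 + Ia2 + Ie1. -/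
open Matrix ComplexOrder

/-- Base-2 logarithm of the (real part of the) determinant. -/
noncomputable def logdet {n : ℕ} (A : Matrix (Fin n) (Fin n) ℂ) : ℝ :=
  Real.logb 2 A.det.re

/-- `τ_{ji}` at receiver `i`: `log det(I + ρc·Hc·Kcu·Hc†)` where `Hc` is the incoming
cross-link matrix (from the other transmitter). -/
noncomputable def tauI {mc n : ℕ} (Hc : Matrix (Fin n) (Fin mc) ℂ) (ρc : ℝ) : ℝ :=
  logdet (1 + (ρc : ℂ) • (Hc * Ku Hc ρc * Hcᴴ))

/-- `Ia_i = log det(I + ρd·Hd·Kdu·Hd† + ρc·Hc·Kcu·Hc†) − τ`, where `Hd` is the direct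
link, `Hx` the outgoing cross link (defining `Kdu = Ku Hx ρx`) and `Hc` the incoming
cross link. -/
noncomputable def Ia {md mc n nx : ℕ} (Hd : Matrix (Fin n) (Fin md) ℂ)
    (Hc : Matrix (Fin n) (Fin mc) ℂ) (Hx : Matrix (Fin nx) (Fin md) ℂ)
    (ρd ρx ρc : ℝ) : ℝ :=
  logdet (1 + (ρd : ℂ) • (Hd * Ku Hx ρx * Hdᴴ) + (ρc : ℂ) • (Hc * Ku Hc ρc * Hcᴴ))
    - tauI Hc ρc

/-- `IW_j` at receiver `i`: `log det(I + (ρc/mc)·Hc·Hc†) − τ`. -/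
noncomputable def IWc {mc n : ℕ} (Hc : Matrix (Fin n) (Fin mc) ℂ) (ρc : ℝ) : ℝ :=
  logdet (1 + ((ρc / mc : ℝ) : ℂ) • (Hc * Hcᴴ)) - tauI Hc ρc

/-- `Id_i = log det(I + (ρd/md)·Hd·Hd† + ρc·Hc·Kcu·Hc†) − τ`. -/
noncomputable def Id' {md mc n : ℕ} (Hd : Matrix (Fin n) (Fin md) ℂ)
    (Hc : Matrix (Fin n) (Fin mc) ℂ) (ρd ρc : ℝ) : ℝ :=
  logdet (1 + ((ρd / md : ℝ) : ℂ) • (Hd * Hdᴴ) + (ρc : ℂ) • (Hc * Ku Hc ρc * Hcᴴ))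
    - tauI Hc ρc

/-- `Ie_i = log det(I + (ρc/mc)·Hc·Hc† + ρd·Hd·Kdu·Hd†) − τ`. -/
noncomputable def Ie {md mc n nx : ℕ} (Hd : Matrix (Fin n) (Fin md) ℂ)
    (Hc : Matrix (Fin n) (Fin mc) ℂ) (Hx : Matrix (Fin nx) (Fin md) ℂ)
    (ρd ρx ρc : ℝ) : ℝ :=
  logdet (1 + ((ρc / mc : ℝ) : ℂ) • (Hc * Hcᴴ) + (ρd : ℂ) • (Hd * Ku Hx ρx * Hdᴴ))
    - tauI Hc ρc

/-- `Ig_i = log det(I + (ρc/mc)·Hc·Hc† + (ρd/md)·Hd·Hd†) − τ`. -/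
noncomputable def Ig {md mc n : ℕ} (Hd : Matrix (Fin n) (Fin md) ℂ)
    (Hc : Matrix (Fin n) (Fin mc) ℂ) (ρd ρc : ℝ) : ℝ :=
  logdet (1 + ((ρc / mc : ℝ) : ℂ) • (Hc * Hcᴴ) + ((ρd / md : ℝ) : ℂ) • (Hd * Hdᴴ))
    - tauI Hc ρc

/-- The constant `n1` of the paper (logs base 2). -/
noncomputable def n1gap (M1 M2 N1 N2 : ℕ) : ℝ :=
  max ((min M1 N1 : ℝ) * Real.logb 2 M1 + (min M1 N2 : ℝ) * Real.logb 2 ((M1 : ℝ) + 1))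
      ((min N1 (M1 + M2) : ℝ) * Real.logb 2 (max M1 M2 : ℝ))
    + (min M2 N1 : ℝ) * Real.logb 2 (((M2 : ℝ) + 1) / M2)

/-- The constant `n2` of the paper (logs base 2). -/
noncomputable def n2gap (M1 M2 N1 N2 : ℕ) : ℝ :=
  max ((min M2 N2 : ℝ) * Real.logb 2 M2 + (min M2 N1 : ℝ) * Real.logb 2 ((M2 : ℝ) + 1))
      ((min N2 (M1 + M2) : ℝ) * Real.logb 2 (max M1 M2 : ℝ))
    + (min M1 N2 : ℝ) * Real.logb 2 (((M1 : ℝ) + 1) / M1)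

/-- The achievable region `R_a(H, ρ̄)` (Lemma 4 of the paper). -/
noncomputable def Ra {M1 N1 M2 N2 : ℕ}
    (H11 : Matrix (Fin N1) (Fin M1) ℂ) (H12 : Matrix (Fin N2) (Fin M1) ℂ)
    (H21 : Matrix (Fin N1) (Fin M2) ℂ) (H22 : Matrix (Fin N2) (Fin M2) ℂ)
    (ρ11 ρ12 ρ21 ρ22 : ℝ) : Set (ℝ × ℝ) :=
  {p : ℝ × ℝ | 0 ≤ p.1 ∧ 0 ≤ p.2 ∧
    p.1 ≤ max (logdet (1 + (ρ11 : ℂ) • (H11 * H11ᴴ)) - n1gap M1 M2 N1 N2) 0 ∧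
    p.2 ≤ max (logdet (1 + (ρ22 : ℂ) • (H22 * H22ᴴ)) - n2gap M1 M2 N1 N2) 0 ∧
    p.1 + p.2 ≤ max (logdet (1 + (ρ12 : ℂ) • (H12 * H12ᴴ) + (ρ22 : ℂ) • (H22 * H22ᴴ))
        + logdet (1 + (ρ11 : ℂ) • (H11 * KK H12 ρ12 * H11ᴴ))
        - (n1gap M1 M2 N1 N2 + n2gap M1 M2 N1 N2)) 0 ∧
    p.1 + p.2 ≤ max (logdet (1 + (ρ21 : ℂ) • (H21 * H21ᴴ) + (ρ11 : ℂ) • (H11 * H11ᴴ))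
        + logdet (1 + (ρ22 : ℂ) • (H22 * KK H21 ρ21 * H22ᴴ))
        - (n1gap M1 M2 N1 N2 + n2gap M1 M2 N1 N2)) 0 ∧
    p.1 + p.2 ≤ max (logdet (1 + (ρ21 : ℂ) • (H21 * H21ᴴ)
            + (ρ11 : ℂ) • (H11 * KK H12 ρ12 * H11ᴴ))
        + logdet (1 + (ρ12 : ℂ) • (H12 * H12ᴴ)
            + (ρ22 : ℂ) • (H22 * KK H21 ρ21 * H22ᴴ))
        - (n1gap M1 M2 N1 N2 + n2gap M1 M2 N1 N2)) 0 ∧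
    2 * p.1 + p.2 ≤ max (logdet (1 + (ρ21 : ℂ) • (H21 * H21ᴴ)
            + (ρ11 : ℂ) • (H11 * H11ᴴ))
        + logdet (1 + (ρ11 : ℂ) • (H11 * KK H12 ρ12 * H11ᴴ))
        + logdet (1 + (ρ12 : ℂ) • (H12 * H12ᴴ)
            + (ρ22 : ℂ) • (H22 * KK H21 ρ21 * H22ᴴ))
        - (2 * n1gap M1 M2 N1 N2 + n2gap M1 M2 N1 N2)) 0 ∧
    p.1 + 2 * p.2 ≤ max (logdet (1 + (ρ12 : ℂ) • (H12 * H12ᴴ)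
            + (ρ22 : ℂ) • (H22 * H22ᴴ))
        + logdet (1 + (ρ22 : ℂ) • (H22 * KK H21 ρ21 * H22ᴴ))
        + logdet (1 + (ρ21 : ℂ) • (H21 * H21ᴴ)
            + (ρ11 : ℂ) • (H11 * KK H12 ρ12 * H11ᴴ))
        - (n1gap M1 M2 N1 N2 + 2 * n2gap M1 M2 N1 N2)) 0}

namespace Matrix

lemma PosSemidef.posDef_one_add {ι : Type*} [DecidableEq ι] {P : Matrix ι ι ℂ}
    (hP : P.PosSemidef) : (1 + P).PosDef :=
  PosDef.one.add_posSemidef hP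

lemma PosSemidef.ofReal_smul {ι : Type*} {P : Matrix ι ι ℂ} (hP : P.PosSemidef)
    {c : ℝ} (hc : 0 ≤ c) :
    ((c : ℂ) • P).PosSemidef :=
  hP.smul (by exact_mod_cast hc)

lemma posDef_one_add_smul_conjTranspose_mul {ι κ : Type*} [Fintype ι]
    [Fintype κ] [DecidableEq κ] (H : Matrix ι κ ℂ) {ρ : ℝ} (hρ : 0 ≤ ρ) :
    (1 + (ρ : ℂ) • (Hᴴ * H)).PosDef :=
  ((posSemidef_conjTranspose_mul_self H).ofReal_smul hρ).posDef_one_add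

variable {ι κ : Type*} [Fintype ι] [DecidableEq ι] [Fintype κ] [DecidableEq κ]

lemma PosSemidef.exists_eq_conjTranspose_mul_self {P : Matrix ι ι ℂ} (hP : P.PosSemidef) :
    ∃ B : Matrix ι ι ℂ, P = Bᴴ * B := by
  open scoped MatrixOrder in
  exact CStarAlgebra.nonneg_iff_eq_star_mul_self.mp hP.nonneg

lemma PosSemidef.one_le_det_one_add_s17 {Q : Matrix ι ι ℂ} (hQ : Q.PosSemidef) :
    1 ≤ (1 + Q).det := by
  have h : (1 + Q).det = ∏ i, ((1 + hQ.1.eigenvalues i : ℝ) : ℂ) := by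
    have h1 := congrArg (Polynomial.eval (-1)) hQ.1.charpoly_eq
    rw [eval_charpoly, Polynomial.eval_prod] at h1
    have h2 : (scalar ι (-1 : ℂ)) - Q = -(1 + Q) := by
      rw [map_neg, map_one, neg_add, sub_eq_add_neg]
    rw [h2, det_neg] at h1
    have h3 : ∀ i, Polynomial.eval (-1) (Polynomial.X - Polynomial.C (hQ.1.eigenvalues i : ℂ))
        = (-1) * ((1 + hQ.1.eigenvalues i : ℝ) : ℂ) := by
      intro i
      push_cast
      simp
      ring
    simp only [Complex.coe_algebraMap] at h1
    rw [Finset.prod_congr rfl fun i _ => h3 i, Finset.prod_mul_distrib, Finset.prod_const,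
      Finset.card_univ] at h1
    exact mul_left_cancel₀ (pow_ne_zero _ (by norm_num)) h1
  rw [h, ← Complex.ofReal_prod]
  have h4 : (1 : ℝ) ≤ ∏ i, (1 + hQ.1.eigenvalues i) :=
    Finset.one_le_prod fun i => by have := hQ.eigenvalues_nonneg i; simpa using this
  exact_mod_cast h4

lemma PosDef.det_le_det_add_s17 {A P : Matrix ι ι ℂ} (hA : A.PosDef) (hP : P.PosSemidef) :
    A.det ≤ (A + P).det := by
  obtain ⟨B, hB⟩ := hA.inv.posSemidef.exists_eq_conjTranspose_mul_self
  have hu : A * A⁻¹ = 1 := mul_nonsing_inv A ((isUnit_iff_isUnit_det A).mp hA.isUnit)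
  have h1 : A + P = A * (1 + A⁻¹ * P) := by rw [mul_add, mul_one, ← mul_assoc, hu, one_mul]
  have h2 : (1 + A⁻¹ * P).det = (1 + B * P * Bᴴ).det := by
    rw [hB, mul_assoc, det_one_add_mul_comm, mul_assoc]
  rw [h1, det_mul, h2]
  exact le_mul_of_one_le_right hA.det_pos.le
    (hP.mul_mul_conjTranspose_same B).one_le_det_one_add_s17

lemma PosSemidef.det_one_add_le_pow_mul_s17 {P : Matrix ι ι ℂ} (hP : P.PosSemidef) {c : ℝ}
    (hc : 1 ≤ c) :
    (1 + P).det ≤ (c : ℂ) ^ Fintype.card ι * (1 + ((c⁻¹ : ℝ) : ℂ) • P).det := by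
  have hc0 : (c : ℂ) ≠ 0 := by exact_mod_cast (by linarith : c ≠ 0)
  have h : (c : ℂ) • (1 + ((c⁻¹ : ℝ) : ℂ) • P) = (1 + P) + ((c - 1 : ℝ) : ℂ) • 1 := by
    rw [smul_add, smul_smul, Complex.ofReal_inv, mul_inv_cancel₀ hc0]
    push_cast
    module
  rw [← det_smul, h]
  exact hP.posDef_one_add.det_le_det_add_s17 (PosSemidef.one.ofReal_smul (by linarith))

lemma det_one_add_mul_conjTranspose_le_pow_mul (A : Matrix ι κ ℂ) {c : ℝ} (hc : 1 ≤ c) :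
    (1 + A * Aᴴ).det ≤ (c : ℂ) ^ Fintype.card κ * (1 + ((c⁻¹ : ℝ) : ℂ) • (A * Aᴴ)).det := by
  rw [← Matrix.smul_mul, det_one_add_mul_comm A, det_one_add_mul_comm _ Aᴴ, Matrix.mul_smul]
  exact (posSemidef_conjTranspose_mul_self A).det_one_add_le_pow_mul_s17 hc

/-- The push-through identity. -/
lemma smul_mul_inv_mul_conjTranspose (H : Matrix ι κ ℂ) {ρ : ℝ} (hρ : 0 ≤ ρ) :
    (ρ : ℂ) • (H * (1 + (ρ : ℂ) • (Hᴴ * H))⁻¹ * Hᴴ) = 1 - (1 + (ρ : ℂ) • (H * Hᴴ))⁻¹ := by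
  set G := 1 + (ρ : ℂ) • (Hᴴ * H) with hG
  set F := 1 + (ρ : ℂ) • (H * Hᴴ) with hF
  have hGu : IsUnit G.det := (isUnit_iff_isUnit_det G).mp
    (posDef_one_add_smul_conjTranspose_mul H hρ).isUnit
  have hFu : IsUnit F.det := by
    have := (posDef_one_add_smul_conjTranspose_mul Hᴴ hρ).isUnit
    rw [conjTranspose_conjTranspose] at this
    exact (isUnit_iff_isUnit_det F).mp this
  have hcomm : F * H = H * G := by
    simp only [hF, hG, Matrix.add_mul, Matrix.mul_add, Matrix.one_mul, Matrix.mul_one,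
      Matrix.smul_mul, Matrix.mul_smul, Matrix.mul_assoc]
  have h1 : H * G⁻¹ = F⁻¹ * H := by
    calc H * G⁻¹ = F⁻¹ * (F * H) * G⁻¹ := by rw [nonsing_inv_mul_cancel_left _ _ hFu]
      _ = F⁻¹ * H := by rw [hcomm, ← Matrix.mul_assoc, mul_nonsing_inv_cancel_right _ _ hGu]
  have h2 : (ρ : ℂ) • (H * Hᴴ) = F - 1 := by rw [hF, add_sub_cancel_left]
  rw [h1, Matrix.mul_assoc, ← Matrix.mul_smul, h2, mul_sub, mul_one, nonsing_inv_mul _ hFu]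

end Matrix

section LogDet

variable {n : ℕ}

lemma logdet_mono {A B : Matrix (Fin n) (Fin n) ℂ} (hA : A.PosDef) (hAB : (B - A).PosSemidef) :
    logdet A ≤ logdet B := by
  have h := hA.det_le_det_add_s17 hAB
  rw [add_sub_cancel] at h
  exact Real.logb_le_logb_of_le one_lt_two (Complex.pos_iff.mp hA.det_pos).1 (Complex.le_def.mp h).1

lemma logdet_one_add_mono {P Q : Matrix (Fin n) (Fin n) ℂ} (hP : P.PosSemidef)
    (hPQ : (Q - P).PosSemidef) : logdet (1 + P) ≤ logdet (1 + Q) :=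
  logdet_mono hP.posDef_one_add (by rwa [add_sub_add_left_eq_sub])

lemma logb_re_le_of_le_pow_mul {a b : ℂ} {c : ℝ} {k : ℕ} (ha : 0 < a) (hb : 0 < b) (hc : 1 ≤ c)
    (h : a ≤ (c : ℂ) ^ k * b) : Real.logb 2 a.re ≤ k * Real.logb 2 c + Real.logb 2 b.re := by
  have hb' := (Complex.pos_iff.mp hb).1
  have hc0 : 0 < c := by linarith
  have h1 : a.re ≤ c ^ k * b.re := by
    have := (Complex.le_def.mp h).1
    rwa [← Complex.ofReal_pow, Complex.re_ofReal_mul] at this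
  rw [← Real.logb_pow, ← Real.logb_mul (by positivity) hb'.ne']
  exact Real.logb_le_logb_of_le one_lt_two (Complex.pos_iff.mp ha).1 h1

lemma logdet_scale {κ : Type*} [Fintype κ] [DecidableEq κ] (A : Matrix (Fin n) κ ℂ) {c : ℝ}
    (hc : 1 ≤ c) {Q : Matrix (Fin n) (Fin n) ℂ}
    (hQ : (Q - ((c⁻¹ : ℝ) : ℂ) • (A * Aᴴ)).PosSemidef) :
    logdet (1 + A * Aᴴ) ≤ min (Fintype.card κ : ℝ) n * Real.logb 2 c + logdet (1 + Q) := by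
  have hA := posSemidef_self_mul_conjTranspose A
  have hcA := hA.ofReal_smul (inv_nonneg.mpr (zero_le_one.trans hc))
  refine le_trans ?_ (add_le_add_right (logdet_one_add_mono hcA hQ) _)
  have h1 := logb_re_le_of_le_pow_mul hA.posDef_one_add.det_pos hcA.posDef_one_add.det_pos hc
    (det_one_add_mul_conjTranspose_le_pow_mul A hc)
  have h2 := logb_re_le_of_le_pow_mul hA.posDef_one_add.det_pos hcA.posDef_one_add.det_pos hc
    (hA.det_one_add_le_pow_mul_s17 hc)
  rw [Fintype.card_fin] at h2
  rcases min_cases (Fintype.card κ : ℝ) n with h | h <;> rw [h.1]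
  · exact h1
  · exact h2

lemma exists_smul_mul_mul_conjTranspose_eq {m : ℕ} (H : Matrix (Fin n) (Fin m) ℂ)
    {K : Matrix (Fin m) (Fin m) ℂ} (hK : K.PosSemidef) {ρ : ℝ} (hρ : 0 ≤ ρ) :
    ∃ A : Matrix (Fin n) (Fin m) ℂ, (ρ : ℂ) • (H * K * Hᴴ) = A * Aᴴ := by
  obtain ⟨B, hB⟩ := (hK.ofReal_smul hρ).exists_eq_conjTranspose_mul_self
  refine ⟨H * Bᴴ, ?_⟩
  rw [conjTranspose_mul, conjTranspose_conjTranspose, Matrix.mul_assoc H, Matrix.mul_assoc H,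
    ← Matrix.mul_assoc Bᴴ, ← hB, Matrix.smul_mul, Matrix.mul_smul]

lemma logdet_scale_add {κ₁ κ₂ : Type*} [Fintype κ₁] [DecidableEq κ₁] [Fintype κ₂] [DecidableEq κ₂]
    (A₁ : Matrix (Fin n) κ₁ ℂ) (A₂ : Matrix (Fin n) κ₂ ℂ) {c : ℝ} (hc : 1 ≤ c)
    {Q₁ Q₂ : Matrix (Fin n) (Fin n) ℂ}
    (hQ₁ : (Q₁ - ((c⁻¹ : ℝ) : ℂ) • (A₁ * A₁ᴴ)).PosSemidef)
    (hQ₂ : (Q₂ - ((c⁻¹ : ℝ) : ℂ) • (A₂ * A₂ᴴ)).PosSemidef) :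
    logdet (1 + A₁ * A₁ᴴ + A₂ * A₂ᴴ) ≤
      min (n : ℝ) (Fintype.card κ₁ + Fintype.card κ₂) * Real.logb 2 c
        + logdet (1 + Q₁ + Q₂) := by
  have hA : fromCols A₁ A₂ * (fromCols A₁ A₂)ᴴ = A₁ * A₁ᴴ + A₂ * A₂ᴴ := by
    rw [conjTranspose_fromCols_eq_fromRows_conjTranspose, fromCols_mul_fromRows]
  have h := logdet_scale (fromCols A₁ A₂) hc (Q := Q₁ + Q₂) (by
    rw [hA, smul_add, add_sub_add_comm]
    exact hQ₁.add hQ₂)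
  rwa [hA, Fintype.card_sum, Nat.cast_add, min_comm, ← add_assoc, ← add_assoc] at h

lemma posSemidef_smul_sub_smul {P : Matrix (Fin n) (Fin n) ℂ} (hP : P.PosSemidef) {a b : ℝ}
    (hab : b ≤ a) : ((a : ℂ) • P - (b : ℂ) • P).PosSemidef := by
  rw [← sub_smul, ← Complex.ofReal_sub]
  exact hP.ofReal_smul (sub_nonneg.mpr hab)

end LogDet

section Receiver

variable {m n : ℕ} {ρ : ℝ}

lemma KK_posDef (H : Matrix (Fin n) (Fin m) ℂ) (hρ : 0 ≤ ρ) : (KK H ρ).PosDef :=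
  (posDef_one_add_smul_conjTranspose_mul H hρ).inv

lemma smul_mul_KK_mul_posSemidef {n' : ℕ} (H : Matrix (Fin n) (Fin m) ℂ)
    (H' : Matrix (Fin n') (Fin m) ℂ) {ρ' : ℝ} (hρ : 0 ≤ ρ) (hρ' : 0 ≤ ρ') :
    ((ρ : ℂ) • (H * KK H' ρ' * Hᴴ)).PosSemidef :=
  ((KK_posDef H' hρ').posSemidef.mul_mul_conjTranspose_same H).ofReal_smul hρ

lemma smul_mul_conjTranspose_posSemidef (H : Matrix (Fin n) (Fin m) ℂ) (hρ : 0 ≤ ρ) :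
    ((ρ : ℂ) • (H * Hᴴ)).PosSemidef :=
  (posSemidef_self_mul_conjTranspose H).ofReal_smul hρ

lemma smul_mul_Ku_mul {n' : ℕ} (H : Matrix (Fin n) (Fin m) ℂ) (H' : Matrix (Fin n') (Fin m) ℂ)
    (ρ ρ' : ℝ) : (ρ : ℂ) • (H * Ku H' ρ' * Hᴴ)
      = (((m : ℝ)⁻¹ : ℝ) : ℂ) • ((ρ : ℂ) • (H * KK H' ρ' * Hᴴ)) := by
  rw [Ku, Matrix.mul_smul, Matrix.smul_mul, smul_comm, Complex.ofReal_inv, Complex.ofReal_natCast]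

lemma div_smul_mul_conjTranspose (H : Matrix (Fin n) (Fin m) ℂ) (ρ : ℝ) :
    ((ρ / m : ℝ) : ℂ) • (H * Hᴴ) = (((m : ℝ)⁻¹ : ℝ) : ℂ) • ((ρ : ℂ) • (H * Hᴴ)) := by
  rw [smul_smul, ← Complex.ofReal_mul, div_eq_inv_mul]

lemma one_sub_KK_posSemidef (H : Matrix (Fin n) (Fin m) ℂ) (hρ : 0 ≤ ρ) :
    (1 - KK H ρ).PosSemidef := by
  have h := smul_mul_inv_mul_conjTranspose Hᴴ hρ
  rw [conjTranspose_conjTranspose] at h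
  rw [KK, ← h]
  have hF := posDef_one_add_smul_conjTranspose_mul Hᴴ hρ
  rw [conjTranspose_conjTranspose] at hF
  exact (hF.inv.posSemidef.conjTranspose_mul_mul_same H).ofReal_smul hρ

lemma smul_sub_smul_mul_KK_mul_posSemidef (H : Matrix (Fin n) (Fin m) ℂ) (hρ : 0 ≤ ρ) :
    ((ρ : ℂ) • (H * Hᴴ) - (ρ : ℂ) • (H * KK H ρ * Hᴴ)).PosSemidef := by
  have h : (ρ : ℂ) • (H * Hᴴ) - (ρ : ℂ) • (H * KK H ρ * Hᴴ)
      = (ρ : ℂ) • (H * (1 - KK H ρ) * Hᴴ) := by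
    rw [Matrix.mul_sub, Matrix.sub_mul, Matrix.mul_one, smul_sub]
  rw [h]
  exact ((one_sub_KK_posSemidef H hρ).mul_mul_conjTranspose_same H).ofReal_smul hρ

lemma det_one_add_inv_smul_one_sub_le {P : Matrix (Fin n) (Fin n) ℂ} (hP : P.PosSemidef)
    (hP' : (1 - P).PosSemidef) (hm : 0 < m) :
    (1 + (((m : ℝ)⁻¹ : ℝ) : ℂ) • (1 - P)).det ≤ ((((m : ℝ) + 1) / m : ℝ) : ℂ) ^ n * 1 := by
  have hm' : (m : ℂ) ≠ 0 := by exact_mod_cast hm.ne'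
  have hi : (0 : ℝ) ≤ (m : ℝ)⁻¹ := by positivity
  have h : (1 + (((m : ℝ)⁻¹ : ℝ) : ℂ) • (1 - P)) + (((m : ℝ)⁻¹ : ℝ) : ℂ) • P
      = ((((m : ℝ) + 1) / m : ℝ) : ℂ) • (1 : Matrix (Fin n) (Fin n) ℂ) := by
    rw [smul_sub, add_assoc, sub_add_cancel, add_div, div_self (by exact_mod_cast hm.ne'),
      Complex.ofReal_add, add_smul, Complex.ofReal_one, one_smul, one_div]
  have h' := (hP'.ofReal_smul hi).posDef_one_add.det_le_det_add_s17 (hP.ofReal_smul hi)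
  rwa [h, det_smul, Fintype.card_fin, det_one] at h'

lemma tauI_le (H : Matrix (Fin n) (Fin m) ℂ) (hρ : 0 ≤ ρ) (hm : 0 < m) :
    tauI H ρ ≤ min (m : ℝ) n * Real.logb 2 (((m : ℝ) + 1) / m) := by
  have hm' : (0 : ℝ) < m := by exact_mod_cast hm
  have hi : (0 : ℝ) ≤ (m : ℝ)⁻¹ := by positivity
  have hc : 1 ≤ ((m : ℝ) + 1) / m := by rw [le_div_iff₀ hm']; linarith
  have hT := smul_mul_KK_mul_posSemidef H H hρ hρ
  have hpos : 0 < (1 + (ρ : ℂ) • (H * Ku H ρ * Hᴴ)).det := by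
    rw [smul_mul_Ku_mul]
    exact (hT.ofReal_smul hi).posDef_one_add.det_pos
  have hF := (posDef_one_add_smul_conjTranspose_mul Hᴴ hρ).inv.posSemidef
  rw [conjTranspose_conjTranspose] at hF
  have hTeq : (ρ : ℂ) • (H * KK H ρ * Hᴴ) = 1 - (1 + (ρ : ℂ) • (H * Hᴴ))⁻¹ :=
    smul_mul_inv_mul_conjTranspose H hρ
  have h1 : (1 + (ρ : ℂ) • (H * Ku H ρ * Hᴴ)).det
      ≤ ((((m : ℝ) + 1) / m : ℝ) : ℂ) ^ n * 1 := by
    rw [smul_mul_Ku_mul, hTeq]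
    exact det_one_add_inv_smul_one_sub_le hF (hTeq ▸ hT) hm
  have h2 : (1 + (ρ : ℂ) • (H * Ku H ρ * Hᴴ)).det
      ≤ ((((m : ℝ) + 1) / m : ℝ) : ℂ) ^ m * 1 := by
    have hu : IsUnit (1 + (ρ : ℂ) • (Hᴴ * H)).det := (isUnit_iff_isUnit_det _).mp
      (posDef_one_add_smul_conjTranspose_mul H hρ).isUnit
    have hK : (ρ : ℂ) • (KK H ρ * Hᴴ * H) = 1 - KK H ρ := by
      have h3 : KK H ρ * (1 + (ρ : ℂ) • (Hᴴ * H)) = 1 := nonsing_inv_mul _ hu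
      rw [Matrix.mul_add, Matrix.mul_one, Matrix.mul_smul] at h3
      rw [Matrix.mul_assoc]
      exact eq_sub_of_add_eq' h3
    rw [smul_mul_Ku_mul, Matrix.mul_assoc H, ← Matrix.mul_smul, ← Matrix.mul_smul,
      det_one_add_mul_comm, Matrix.smul_mul, Matrix.smul_mul, hK]
    exact det_one_add_inv_smul_one_sub_le (KK_posDef H hρ).posSemidef
      (one_sub_KK_posSemidef H hρ) hm
  have e1 := logb_re_le_of_le_pow_mul hpos one_pos hc h1
  have e2 := logb_re_le_of_le_pow_mul hpos one_pos hc h2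
  rw [Complex.one_re, Real.logb_one, add_zero] at e1 e2
  rcases min_cases (m : ℝ) n with h | h <;> rw [h.1]
  · exact e2
  · exact e1

variable {md mc nx : ℕ} (Hd : Matrix (Fin n) (Fin md) ℂ) (Hc : Matrix (Fin n) (Fin mc) ℂ)
  (Hx : Matrix (Fin nx) (Fin md) ℂ) {ρd ρx ρc : ℝ}

lemma tauI_eq : tauI Hc ρc
    = logdet (1 + (((mc : ℝ)⁻¹ : ℝ) : ℂ) • ((ρc : ℂ) • (Hc * KK Hc ρc * Hcᴴ))) := by
  rw [tauI, smul_mul_Ku_mul]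

/-- Replacing the private covariance of the interferer by its full covariance and adding a positive
semidefinite term can only increase the received information. -/
lemma tauI_le_logdet_add (hc : 0 ≤ ρc) {Q : Matrix (Fin n) (Fin n) ℂ} (hQ : Q.PosSemidef) :
    tauI Hc ρc ≤ logdet (1 + ((ρc / mc : ℝ) : ℂ) • (Hc * Hcᴴ) + Q) := by
  rw [tauI_eq, div_smul_mul_conjTranspose, add_assoc]
  have hi : (0 : ℝ) ≤ (mc : ℝ)⁻¹ := by positivity
  refine logdet_one_add_mono ((smul_mul_KK_mul_posSemidef Hc Hc hc hc).ofReal_smul hi) ?_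
  rw [add_sub_right_comm, ← smul_sub]
  exact ((smul_sub_smul_mul_KK_mul_posSemidef Hc hc).ofReal_smul hi).add hQ

/-- A positive semidefinite signal term can only increase the received information. -/
lemma tauI_le_logdet_add' (hc : 0 ≤ ρc) {Q : Matrix (Fin n) (Fin n) ℂ} (hQ : Q.PosSemidef) :
    tauI Hc ρc ≤ logdet (1 + Q + (ρc : ℂ) • (Hc * Ku Hc ρc * Hcᴴ)) := by
  rw [tauI_eq, smul_mul_Ku_mul, add_assoc]
  have hi : (0 : ℝ) ≤ (mc : ℝ)⁻¹ := by positivity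
  refine logdet_one_add_mono ((smul_mul_KK_mul_posSemidef Hc Hc hc hc).ofReal_smul hi) ?_
  rwa [add_sub_cancel_right]

lemma smul_mul_Ku_mul_posSemidef (hd : 0 ≤ ρd) (hx : 0 ≤ ρx) :
    ((ρd : ℂ) • (Hd * Ku Hx ρx * Hdᴴ)).PosSemidef := by
  rw [smul_mul_Ku_mul]
  exact (smul_mul_KK_mul_posSemidef Hd Hx hd hx).ofReal_smul (by positivity)

lemma Ia_nonneg (hd : 0 ≤ ρd) (hx : 0 ≤ ρx) (hc : 0 ≤ ρc) : 0 ≤ Ia Hd Hc Hx ρd ρx ρc :=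
  sub_nonneg.mpr (tauI_le_logdet_add' Hc hc (smul_mul_Ku_mul_posSemidef Hd Hx hd hx))

lemma IWc_nonneg (hc : 0 ≤ ρc) : 0 ≤ IWc Hc ρc := by
  have h := tauI_le_logdet_add Hc hc (PosSemidef.zero (n := Fin n))
  rw [add_zero] at h
  exact sub_nonneg.mpr h

lemma Id'_nonneg (hd : 0 ≤ ρd) (hc : 0 ≤ ρc) : 0 ≤ Id' Hd Hc ρd ρc :=
  sub_nonneg.mpr (tauI_le_logdet_add' Hc hc (smul_mul_conjTranspose_posSemidef Hd (by positivity)))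

lemma Ie_nonneg (hd : 0 ≤ ρd) (hx : 0 ≤ ρx) (hc : 0 ≤ ρc) : 0 ≤ Ie Hd Hc Hx ρd ρx ρc :=
  sub_nonneg.mpr (tauI_le_logdet_add Hc hc (smul_mul_Ku_mul_posSemidef Hd Hx hd hx))

lemma Ig_nonneg (hd : 0 ≤ ρd) (hc : 0 ≤ ρc) : 0 ≤ Ig Hd Hc ρd ρc :=
  sub_nonneg.mpr (tauI_le_logdet_add Hc hc (smul_mul_conjTranspose_posSemidef Hd (by positivity)))

lemma exists_smul_mul_conjTranspose_eq (hd : 0 ≤ ρd) :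
    ∃ A : Matrix (Fin n) (Fin md) ℂ, (ρd : ℂ) • (Hd * Hdᴴ) = A * Aᴴ := by
  simpa using exists_smul_mul_mul_conjTranspose_eq Hd PosSemidef.one hd

lemma Ia_ge (hmd : 0 < md) (hmc : 0 < mc) (hd : 0 ≤ ρd) (hx : 0 ≤ ρx) (hc : 0 ≤ ρc) :
    logdet (1 + (ρd : ℂ) • (Hd * KK Hx ρx * Hdᴴ)) - min (md : ℝ) n * Real.logb 2 md
      - min (mc : ℝ) n * Real.logb 2 (((mc : ℝ) + 1) / mc) ≤ Ia Hd Hc Hx ρd ρx ρc := by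
  obtain ⟨A, hA⟩ := exists_smul_mul_mul_conjTranspose_eq Hd (KK_posDef Hx hx).posSemidef hd
  have h := logdet_scale A (c := md) (by exact_mod_cast hmd)
    (Q := (ρd : ℂ) • (Hd * Ku Hx ρx * Hdᴴ) + (ρc : ℂ) • (Hc * Ku Hc ρc * Hcᴴ)) (by
      rw [smul_mul_Ku_mul Hd, hA, add_sub_cancel_left]
      exact smul_mul_Ku_mul_posSemidef Hc Hc hc hc)
  rw [← hA, Fintype.card_fin, ← add_assoc] at h
  have ht := tauI_le Hc hc hmc
  rw [Ia]
  linarith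

lemma Id'_ge (hmd : 0 < md) (hmc : 0 < mc) (hd : 0 ≤ ρd) (hc : 0 ≤ ρc) :
    logdet (1 + (ρd : ℂ) • (Hd * Hdᴴ)) - min (md : ℝ) n * Real.logb 2 md
      - min (mc : ℝ) n * Real.logb 2 (((mc : ℝ) + 1) / mc) ≤ Id' Hd Hc ρd ρc := by
  obtain ⟨A, hA⟩ := exists_smul_mul_conjTranspose_eq Hd hd
  have h := logdet_scale A (c := md) (by exact_mod_cast hmd)
    (Q := ((ρd / md : ℝ) : ℂ) • (Hd * Hdᴴ) + (ρc : ℂ) • (Hc * Ku Hc ρc * Hcᴴ)) (by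
      rw [div_smul_mul_conjTranspose Hd, hA, add_sub_cancel_left]
      exact smul_mul_Ku_mul_posSemidef Hc Hc hc hc)
  rw [← hA, Fintype.card_fin, ← add_assoc] at h
  have ht := tauI_le Hc hc hmc
  rw [Id']
  linarith

lemma IWc_ge (hmc : 0 < mc) (hc : 0 ≤ ρc) :
    logdet (1 + (ρc : ℂ) • (Hc * Hcᴴ)) - min (mc : ℝ) n * Real.logb 2 ((mc : ℝ) + 1)
      ≤ IWc Hc ρc := by
  obtain ⟨A, hA⟩ := exists_smul_mul_conjTranspose_eq Hc hc
  have h := logdet_scale A (c := mc) (by exact_mod_cast hmc)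
    (Q := ((ρc / mc : ℝ) : ℂ) • (Hc * Hcᴴ)) (by
      rw [div_smul_mul_conjTranspose Hc, hA, sub_self]
      exact PosSemidef.zero)
  rw [← hA, Fintype.card_fin] at h
  have ht := tauI_le Hc hc hmc
  rw [Real.logb_div (by positivity) (by positivity), mul_sub] at ht
  rw [IWc]
  linarith

lemma Ie_ge (hmd : 0 < md) (hmc : 0 < mc) (hd : 0 ≤ ρd) (hx : 0 ≤ ρx) (hc : 0 ≤ ρc) {c : ℝ}
    (hdc : md ≤ c) (hcc : mc ≤ c) :
    logdet (1 + (ρc : ℂ) • (Hc * Hcᴴ) + (ρd : ℂ) • (Hd * KK Hx ρx * Hdᴴ))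
      - min (n : ℝ) (mc + md) * Real.logb 2 c
      - min (mc : ℝ) n * Real.logb 2 (((mc : ℝ) + 1) / mc) ≤ Ie Hd Hc Hx ρd ρx ρc := by
  obtain ⟨A, hA⟩ := exists_smul_mul_conjTranspose_eq Hc hc
  obtain ⟨B, hB⟩ := exists_smul_mul_mul_conjTranspose_eq Hd (KK_posDef Hx hx).posSemidef hd
  have h1 : (1 : ℝ) ≤ md := by exact_mod_cast hmd
  have h2 : (0 : ℝ) < mc := by exact_mod_cast hmc
  have h := logdet_scale_add A B (h1.trans hdc) (Q₁ := ((ρc / mc : ℝ) : ℂ) • (Hc * Hcᴴ))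
    (Q₂ := (ρd : ℂ) • (Hd * Ku Hx ρx * Hdᴴ))
    (by
      rw [div_smul_mul_conjTranspose, hA]
      exact posSemidef_smul_sub_smul (posSemidef_self_mul_conjTranspose A) (by gcongr))
    (by
      rw [smul_mul_Ku_mul, hB]
      exact posSemidef_smul_sub_smul (posSemidef_self_mul_conjTranspose B) (by gcongr))
  rw [← hA, ← hB, Fintype.card_fin, Fintype.card_fin] at h
  have ht := tauI_le Hc hc hmc
  rw [Ie]
  linarith

lemma Ig_ge (hmd : 0 < md) (hmc : 0 < mc) (hd : 0 ≤ ρd) (hc : 0 ≤ ρc) {c : ℝ}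
    (hdc : md ≤ c) (hcc : mc ≤ c) :
    logdet (1 + (ρc : ℂ) • (Hc * Hcᴴ) + (ρd : ℂ) • (Hd * Hdᴴ))
      - min (n : ℝ) (mc + md) * Real.logb 2 c
      - min (mc : ℝ) n * Real.logb 2 (((mc : ℝ) + 1) / mc) ≤ Ig Hd Hc ρd ρc := by
  obtain ⟨A, hA⟩ := exists_smul_mul_conjTranspose_eq Hc hc
  obtain ⟨B, hB⟩ := exists_smul_mul_conjTranspose_eq Hd hd
  have h1 : (1 : ℝ) ≤ md := by exact_mod_cast hmd
  have h2 : (0 : ℝ) < mc := by exact_mod_cast hmc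
  have h := logdet_scale_add A B (h1.trans hdc) (Q₁ := ((ρc / mc : ℝ) : ℂ) • (Hc * Hcᴴ))
    (Q₂ := ((ρd / md : ℝ) : ℂ) • (Hd * Hdᴴ))
    (by
      rw [div_smul_mul_conjTranspose, hA]
      exact posSemidef_smul_sub_smul (posSemidef_self_mul_conjTranspose A) (by gcongr))
    (by
      rw [div_smul_mul_conjTranspose, hB]
      exact posSemidef_smul_sub_smul (posSemidef_self_mul_conjTranspose B) (by gcongr))
  rw [← hA, ← hB, Fintype.card_fin, Fintype.card_fin] at h
  have ht := tauI_le Hc hc hmc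
  rw [Ig]
  linarith

/-- The information carried by a direct link splits into what is received over the cross link and
what remains given that. -/
lemma logdet_direct_le_add (hd : 0 ≤ ρd) (hx : 0 ≤ ρx) :
    logdet (1 + (ρd : ℂ) • (Hd * Hdᴴ))
      ≤ logdet (1 + (ρd : ℂ) • (Hd * KK Hx ρx * Hdᴴ)) + logdet (1 + (ρx : ℂ) • (Hx * Hxᴴ)) := by
  have hG := posDef_one_add_smul_conjTranspose_mul Hx hx
  have hD := posDef_one_add_smul_conjTranspose_mul Hd hd
  have hu : IsUnit (1 + (ρx : ℂ) • (Hxᴴ * Hx)).det := (isUnit_iff_isUnit_det _).mp hG.isUnit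
  have hX : (0 : ℂ) < (1 + (ρx : ℂ) • (Hx * Hxᴴ)).det :=
    (smul_mul_conjTranspose_posSemidef Hx hx).posDef_one_add.det_pos
  have hK : (0 : ℂ) < (1 + (ρd : ℂ) • (Hd * KK Hx ρx * Hdᴴ)).det :=
    (smul_mul_KK_mul_posSemidef Hd Hx hd hx).posDef_one_add.det_pos
  have hdir : (1 + (ρd : ℂ) • (Hd * Hdᴴ)).det = (1 + (ρd : ℂ) • (Hdᴴ * Hd)).det := by
    rw [← Matrix.smul_mul, det_one_add_mul_comm, Matrix.mul_smul]
  have hprod : (1 + (ρd : ℂ) • (Hd * KK Hx ρx * Hdᴴ)).det * (1 + (ρx : ℂ) • (Hx * Hxᴴ)).det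
      = (1 + (ρd : ℂ) • (Hdᴴ * Hd) + (ρx : ℂ) • (Hxᴴ * Hx)).det := by
    have e1 : (1 + (ρx : ℂ) • (Hx * Hxᴴ)).det = (1 + (ρx : ℂ) • (Hxᴴ * Hx)).det := by
      rw [← Matrix.smul_mul, det_one_add_mul_comm, Matrix.mul_smul]
    have e2 : (1 + (ρd : ℂ) • (Hd * KK Hx ρx * Hdᴴ)).det
        = (1 + KK Hx ρx * ((ρd : ℂ) • (Hdᴴ * Hd))).det := by
      rw [Matrix.mul_assoc, ← Matrix.mul_smul, det_one_add_mul_comm, Matrix.smul_mul,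
        Matrix.mul_smul, Matrix.mul_assoc]
    rw [e1, e2, mul_comm, ← det_mul, Matrix.mul_add, Matrix.mul_one, KK,
      mul_nonsing_inv_cancel_left _ _ hu, add_right_comm]
  have hle := hD.det_le_det_add_s17
    ((posSemidef_conjTranspose_mul_self Hx).ofReal_smul hx)
  rw [← hprod, ← hdir] at hle
  have hpos : (0 : ℂ) < (1 + (ρd : ℂ) • (Hd * Hdᴴ)).det := hdir ▸ hD.det_pos
  rw [Complex.pos_iff] at hX hK hpos
  have hre := (Complex.le_def.mp hle).1
  rw [Complex.mul_re, ← hK.2, zero_mul, sub_zero] at hre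
  rw [logdet, logdet, logdet, ← Real.logb_mul hK.1.ne' hX.1.ne']
  exact Real.logb_le_logb_of_le one_lt_two hpos.1 hre

end Receiver

/-- Lemma 4 of the paper. Every rate pair of `R_a` satisfies the nine
inequalities of the explicit Gaussian Han–Kobayashi region `R^{G_e}_{HK}(P_s)`. -/
theorem stmt_17 (M1 N1 M2 N2 : ℕ) (hM1 : 0 < M1) (hN1 : 0 < N1) (hM2 : 0 < M2) (hN2 : 0 < N2)
    (H11 : Matrix (Fin N1) (Fin M1) ℂ) (H12 : Matrix (Fin N2) (Fin M1) ℂ)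
    (H21 : Matrix (Fin N1) (Fin M2) ℂ) (H22 : Matrix (Fin N2) (Fin M2) ℂ)
    (ρ11 ρ12 ρ21 ρ22 : ℝ) (h11 : 0 ≤ ρ11) (h12 : 0 ≤ ρ12) (h21 : 0 ≤ ρ21) (h22 : 0 ≤ ρ22)
    (R1 R2 : ℝ) (hmem : (R1, R2) ∈ Ra H11 H12 H21 H22 ρ11 ρ12 ρ21 ρ22) :
    R1 ≤ Id' H11 H21 ρ11 ρ21 ∧
    R1 ≤ Ia H11 H21 H12 ρ11 ρ12 ρ21 + IWc H12 ρ12 ∧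
    R2 ≤ Id' H22 H12 ρ22 ρ12 ∧
    R2 ≤ Ia H22 H12 H21 ρ22 ρ21 ρ12 + IWc H21 ρ21 ∧
    R1 + R2 ≤ Ig H22 H12 ρ22 ρ12 + Ia H11 H21 H12 ρ11 ρ12 ρ21 ∧
    R1 + R2 ≤ Ig H11 H21 ρ11 ρ21 + Ia H22 H12 H21 ρ22 ρ21 ρ12 ∧
    R1 + R2 ≤ Ie H11 H21 H12 ρ11 ρ12 ρ21 + Ie H22 H12 H21 ρ22 ρ21 ρ12 ∧
    2 * R1 + R2 ≤ Ig H11 H21 ρ11 ρ21 + Ia H11 H21 H12 ρ11 ρ12 ρ21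
        + Ie H22 H12 H21 ρ22 ρ21 ρ12 ∧
    R1 + 2 * R2 ≤ Ig H22 H12 ρ22 ρ12 + Ia H22 H12 H21 ρ22 ρ21 ρ12
        + Ie H11 H21 H12 ρ11 ρ12 ρ21 := by
  obtain ⟨-, -, r1, r2, r3, r4, r5, r6, r7⟩ := hmem
  dsimp only at r1 r2 r3 r4 r5 r6 r7
  have hM1' : (1 : ℝ) ≤ M1 := by exact_mod_cast hM1
  have hM2' : (1 : ℝ) ≤ M2 := by exact_mod_cast hM2
  have p1 : 0 ≤ min (M1 : ℝ) N2 * Real.logb 2 ((M1 : ℝ) + 1) :=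
    mul_nonneg (by positivity) (Real.logb_nonneg one_lt_two (by linarith))
  have p2 : 0 ≤ min (M2 : ℝ) N1 * Real.logb 2 ((M2 : ℝ) + 1) :=
    mul_nonneg (by positivity) (Real.logb_nonneg one_lt_two (by linarith))
  have g1 : min (M1 : ℝ) N1 * Real.logb 2 M1 + min (M1 : ℝ) N2 * Real.logb 2 ((M1 : ℝ) + 1)
      + min (M2 : ℝ) N1 * Real.logb 2 (((M2 : ℝ) + 1) / M2) ≤ n1gap M1 M2 N1 N2 :=
    add_le_add_left (le_max_left _ _) _
  have g1' : min (N1 : ℝ) (M1 + M2) * Real.logb 2 (max M1 M2 : ℝ)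
      + min (M2 : ℝ) N1 * Real.logb 2 (((M2 : ℝ) + 1) / M2) ≤ n1gap M1 M2 N1 N2 :=
    add_le_add_left (le_max_right _ _) _
  have g2 : min (M2 : ℝ) N2 * Real.logb 2 M2 + min (M2 : ℝ) N1 * Real.logb 2 ((M2 : ℝ) + 1)
      + min (M1 : ℝ) N2 * Real.logb 2 (((M1 : ℝ) + 1) / M1) ≤ n2gap M1 M2 N1 N2 :=
    add_le_add_left (le_max_left _ _) _
  have g2' : min (N2 : ℝ) (M1 + M2) * Real.logb 2 (max M1 M2 : ℝ)
      + min (M1 : ℝ) N2 * Real.logb 2 (((M1 : ℝ) + 1) / M1) ≤ n2gap M1 M2 N1 N2 :=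
    add_le_add_left (le_max_right _ _) _
  have hl : (M1 : ℝ) ≤ max (M1 : ℝ) M2 := le_max_left _ _
  have hr : (M2 : ℝ) ≤ max (M1 : ℝ) M2 := le_max_right _ _
  have a1 := Ia_ge H11 H21 H12 hM1 hM2 h11 h12 h21
  have a2 := Ia_ge H22 H12 H21 hM2 hM1 h22 h21 h12
  have a1' := Ia_nonneg H11 H21 H12 h11 h12 h21
  have a2' := Ia_nonneg H22 H12 H21 h22 h21 h12
  have d1 := Id'_ge H11 H21 hM1 hM2 h11 h21
  have d2 := Id'_ge H22 H12 hM2 hM1 h22 h12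
  have d1' := Id'_nonneg H11 H21 h11 h21
  have d2' := Id'_nonneg H22 H12 h22 h12
  have w1 := IWc_ge H12 hM1 h12
  have w2 := IWc_ge H21 hM2 h21
  have w1' := IWc_nonneg H12 h12
  have w2' := IWc_nonneg H21 h21
  have e1 := Ie_ge H11 H21 H12 hM1 hM2 h11 h12 h21 hl hr
  have e2 := Ie_ge H22 H12 H21 hM2 hM1 h22 h21 h12 hr hl
  have e1' := Ie_nonneg H11 H21 H12 h11 h12 h21
  have e2' := Ie_nonneg H22 H12 H21 h22 h21 h12
  have k1 := Ig_ge H11 H21 hM1 hM2 h11 h21 hl hr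
  have k2 := Ig_ge H22 H12 hM2 hM1 h22 h12 hr hl
  have k1' := Ig_nonneg H11 H21 h11 h21
  have k2' := Ig_nonneg H22 H12 h22 h12
  have s1 := logdet_direct_le_add H11 H12 h11 h12
  have s2 := logdet_direct_le_add H22 H21 h22 h21
  rw [add_comm (M2 : ℝ) M1] at e1 k1
  refine ⟨r1.trans (max_le ?_ ?_), r1.trans (max_le ?_ ?_), r2.trans (max_le ?_ ?_),
    r2.trans (max_le ?_ ?_), r3.trans (max_le ?_ ?_), r4.trans (max_le ?_ ?_),
    r5.trans (max_le ?_ ?_), r6.trans (max_le ?_ ?_), r7.trans (max_le ?_ ?_)⟩ <;>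
  linarith
end
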